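/- arXiv:1804.03016 — 5 statements merged into one kernel-verified Lean document; each statement's English description precedes it below -/
import Mathlib

section
/- Let n ≥ Q, let K be a symmetric positive definite real n×n matrix, let P be a real n×Q matrix of full column rank Q, and let f ∈ ℝⁿ, η ∈ ℝ^Q. For each σ > 0 let (α_σ, β_σ) ∈ ℝⁿ × ℝ^Q be the unique solution of Kα + Pβ = f and Pᵀα − σ⁻²β = −η. Then as σ → ∞, (α_σ, β_σ) converges to (α₀, β₀), the unique solution of Kα + Pβ = f and Pᵀα = −η. -/
open Matrix Filter

/-- Solutions of a convergent family of linear systems converge, if the limit is nonsingular. -/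
theorem Matrix.tendsto_of_mulVec_eq {ι m 𝕜 : Type*} [Fintype m] [DecidableEq m] [Field 𝕜]
    [TopologicalSpace 𝕜] [IsTopologicalDivisionRing 𝕜] [T1Space 𝕜] {l : Filter ι}
    {M : ι → Matrix m m 𝕜} {A : Matrix m m 𝕜} {x : ι → m → 𝕜} {x₀ b : m → 𝕜}
    (hA : A.det ≠ 0) (hM : Tendsto M l (nhds A))
    (hx : ∀ᶠ i in l, M i *ᵥ x i = b) (hx₀ : A *ᵥ x₀ = b) :
    Tendsto x l (nhds x₀) := by
  have solve : ∀ (B : Matrix m m 𝕜) (y : m → 𝕜), B.det ≠ 0 → B *ᵥ y = b →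
      B.det⁻¹ • (B.adjugate *ᵥ b) = y := by
    intro B y hB hy
    rw [← hy, mulVec_mulVec, adjugate_mul, smul_mulVec, one_mulVec, inv_smul_smul₀ hB]
  have hdet : Tendsto (fun i ↦ (M i).det) l (nhds A.det) :=
    ((continuous_id.matrix_det).tendsto A).comp hM
  have hadj : Tendsto (fun i ↦ (M i).adjugate *ᵥ b) l (nhds (A.adjugate *ᵥ b)) :=
    ((continuous_id.matrix_adjugate.matrix_mulVec continuous_const).tendsto A).comp hM
  rw [← solve A x₀ hA hx₀]
  refine ((hdet.inv₀ hA).smul hadj).congr' ?_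
  filter_upwards [hx, hdet.eventually_ne hA] with i hi hdi using solve _ _ hdi hi

/-- The saddle point matrix of a positive definite matrix and a matrix with injective action
is nonsingular. -/
theorem Matrix.PosDef.det_fromBlocks_transpose_zero_ne_zero {m n : Type*} [Fintype m]
    [DecidableEq m] [Fintype n] [DecidableEq n] {K : Matrix m m ℝ} (hK : K.PosDef)
    {P : Matrix m n ℝ} (hP : Function.Injective P.mulVec) :
    (fromBlocks K P Pᵀ 0).det ≠ 0 := by
  intro hdet
  obtain ⟨v, hv, hv0⟩ := exists_mulVec_eq_zero_iff.mpr hdet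
  obtain ⟨a, b, rfl⟩ : ∃ a b, v = Sum.elim a b := ⟨_, _, (Sum.elim_comp_inl_inr v).symm⟩
  rw [fromBlocks_mulVec] at hv0
  have h1 : K *ᵥ a + P *ᵥ b = 0 := by
    simpa using congrArg (fun w ↦ w ∘ Sum.inl) hv0
  have h2 : Pᵀ *ᵥ a = 0 := by
    simpa using congrArg (fun w ↦ w ∘ Sum.inr) hv0
  have ha : a = 0 := by
    by_contra ha
    have hpos : 0 < a ⬝ᵥ K *ᵥ a := by simpa using hK.dotProduct_mulVec_pos ha
    have hsum := congrArg (a ⬝ᵥ ·) h1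
    simp only [dotProduct_add, dotProduct_mulVec a P, ← mulVec_transpose, h2,
      zero_dotProduct, add_zero, dotProduct_zero] at hsum
    exact hpos.ne' hsum
  have hb : b = 0 := hP (by simpa [ha] using h1)
  exact hv (by simp [ha, hb])

theorem stmt_4 (n Q : ℕ) (hnQ : Q ≤ n)
    (K : Matrix (Fin n) (Fin n) ℝ) (hK : K.PosDef)
    (P : Matrix (Fin n) (Fin Q) ℝ) (hP : P.rank = Q)
    (f : Fin n → ℝ) (η : Fin Q → ℝ)
    (α : ℝ → Fin n → ℝ) (β : ℝ → Fin Q → ℝ)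
    (hsol : ∀ σ : ℝ, 0 < σ →
      K.mulVec (α σ) + P.mulVec (β σ) = f ∧
      Pᵀ.mulVec (α σ) - (σ ^ 2)⁻¹ • β σ = -η)
    (α₀ : Fin n → ℝ) (β₀ : Fin Q → ℝ)
    (hsol₀ : K.mulVec α₀ + P.mulVec β₀ = f ∧ Pᵀ.mulVec α₀ = -η) :
    Tendsto α atTop (nhds α₀) ∧ Tendsto β atTop (nhds β₀) := by
  have hinj : Function.Injective P.mulVec := by
    rw [mulVec_injective_iff, linearIndependent_iff_card_eq_finrank_span, Fintype.card_fin,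
      Set.finrank, ← rank_eq_finrank_span_cols, hP]
  have hM : Tendsto (fun σ : ℝ ↦ fromBlocks K P Pᵀ (-((σ ^ 2)⁻¹ • (1 : Matrix (Fin Q) (Fin Q) ℝ))))
      atTop (nhds (fromBlocks K P Pᵀ 0)) := by
    have hcont : Continuous fun t : ℝ ↦
        fromBlocks K P Pᵀ (-(t • (1 : Matrix (Fin Q) (Fin Q) ℝ))) := by fun_prop
    have hinv : Tendsto (fun σ : ℝ ↦ (σ ^ 2)⁻¹) atTop (nhds 0) :=
      (tendsto_pow_atTop two_ne_zero).inv_tendsto_atTop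
    simpa [Function.comp_def] using (hcont.tendsto 0).comp hinv
  have hlim : Tendsto (fun σ ↦ Sum.elim (α σ) (β σ)) atTop (nhds (Sum.elim α₀ β₀)) := by
    refine tendsto_of_mulVec_eq (b := Sum.elim f (-η))
      (hK.det_fromBlocks_transpose_zero_ne_zero hinj) hM ?_ ?_
    · filter_upwards [eventually_gt_atTop 0] with σ hσ
      obtain ⟨h1, h2⟩ := hsol σ hσ
      simp [fromBlocks_mulVec, h1, ← h2, neg_mulVec, smul_mulVec, sub_eq_add_neg]
    · simp [fromBlocks_mulVec, hsol₀.1, hsol₀.2]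
  rw [tendsto_pi_nhds] at hlim
  exact ⟨tendsto_pi_nhds.mpr fun i ↦ hlim (.inl i), tendsto_pi_nhds.mpr fun j ↦ hlim (.inr j)⟩
end

section
/- Let n ≥ Q, let K be a symmetric positive definite real n×n matrix, let P be a real n×Q matrix of full column rank Q, and let a, b ∈ ℝⁿ, q, r ∈ ℝ^Q, c ∈ ℝ. For each σ > 0 the matrix K + σ²PPᵀ is invertible, and as σ → ∞, the quantity c + σ² qᵀr − (a + σ²Pq)ᵀ(K + σ²PPᵀ)⁻¹(b + σ²Pr) converges to c − aᵀK⁻¹b + (PᵀK⁻¹a − q)ᵀ(PᵀK⁻¹P)⁻¹(PᵀK⁻¹b − r). -/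
open Matrix Filter

namespace Matrix

variable {m k : Type*} [Fintype k]

theorem mulVec_injective_of_rank_eq_card {𝕜 : Type*} [Field 𝕜] {P : Matrix m k 𝕜}
    (hP : P.rank = Fintype.card k) : Function.Injective P.mulVec := by
  rw [mulVec_injective_iff, linearIndependent_iff_card_eq_finrank_span, ← hP,
    rank_eq_finrank_span_cols]
  rfl

variable [Fintype m] [DecidableEq m] [DecidableEq k]

/-- A form of the Woodbury identity, applied to a vector `b + s • P *ᵥ r`. -/
theorem inv_add_smul_mul_transpose_mulVec {𝕜 : Type*} [Field 𝕜] {K : Matrix m m 𝕜}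
    {P : Matrix m k 𝕜} {s : 𝕜} (hs : s ≠ 0) (hK : IsUnit K) (hA : IsUnit (K + s • (P * Pᵀ)))
    {b : m → 𝕜} {r y : k → 𝕜}
    (hy : (s⁻¹ • 1 + Pᵀ * K⁻¹ * P) *ᵥ y = Pᵀ *ᵥ (K⁻¹ *ᵥ b) - r) :
    (K + s • (P * Pᵀ))⁻¹ *ᵥ (b + s • P *ᵥ r) = K⁻¹ *ᵥ b - K⁻¹ *ᵥ (P *ᵥ y) := by
  have hK' (v : m → 𝕜) : K *ᵥ (K⁻¹ *ᵥ v) = v := by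
    rw [mulVec_mulVec, mul_nonsing_inv _ ((isUnit_iff_isUnit_det K).1 hK), one_mulVec]
  have hr : Pᵀ *ᵥ (K⁻¹ *ᵥ b) - Pᵀ *ᵥ (K⁻¹ *ᵥ (P *ᵥ y)) = r + s⁻¹ • y := by
    simp only [add_mulVec, smul_mulVec, one_mulVec, ← mulVec_mulVec] at hy
    linear_combination -hy
  have h : b + s • P *ᵥ r = (K + s • (P * Pᵀ)) *ᵥ (K⁻¹ *ᵥ b - K⁻¹ *ᵥ (P *ᵥ y)) := by
    rw [add_mulVec, smul_mulVec, ← mulVec_mulVec, mulVec_sub Pᵀ, hr, mulVec_sub, hK', hK',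
      mulVec_add, mulVec_smul, smul_add, smul_inv_smul₀ hs]
    abel
  rw [h, mulVec_mulVec, nonsing_inv_mul _ ((isUnit_iff_isUnit_det _).1 hA), one_mulVec]

theorem add_mul_dotProduct_sub_dotProduct_inv_mulVec {𝕜 : Type*} [Field 𝕜] {K : Matrix m m 𝕜}
    {P : Matrix m k 𝕜} {s : 𝕜} (hs : s ≠ 0) (hKs : K.IsSymm) (hK : IsUnit K)
    (hA : IsUnit (K + s • (P * Pᵀ))) (hM : IsUnit (s⁻¹ • 1 + Pᵀ * K⁻¹ * P))
    (a b : m → 𝕜) (q r : k → 𝕜) (c : 𝕜) :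
    c + s * (q ⬝ᵥ r) -
        (a + s • P *ᵥ q) ⬝ᵥ (K + s • (P * Pᵀ))⁻¹ *ᵥ (b + s • P *ᵥ r) =
      c - a ⬝ᵥ K⁻¹ *ᵥ b +
        (Pᵀ *ᵥ (K⁻¹ *ᵥ a) - q) ⬝ᵥ
          (s⁻¹ • 1 + Pᵀ * K⁻¹ * P)⁻¹ *ᵥ (Pᵀ *ᵥ (K⁻¹ *ᵥ b) - r) := by
  set y := (s⁻¹ • 1 + Pᵀ * K⁻¹ * P)⁻¹ *ᵥ (Pᵀ *ᵥ (K⁻¹ *ᵥ b) - r) with hy_def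
  have hy : (s⁻¹ • 1 + Pᵀ * K⁻¹ * P) *ᵥ y = Pᵀ *ᵥ (K⁻¹ *ᵥ b) - r := by
    rw [hy_def, mulVec_mulVec, mul_nonsing_inv _ ((isUnit_iff_isUnit_det _).1 hM), one_mulVec]
  have hP (x : k → 𝕜) (v : m → 𝕜) : (P *ᵥ x) ⬝ᵥ v = x ⬝ᵥ Pᵀ *ᵥ v := by
    rw [mulVec_transpose, dotProduct_comm, dotProduct_mulVec, dotProduct_comm]
  have hKinv (u v : m → 𝕜) : u ⬝ᵥ K⁻¹ *ᵥ v = (K⁻¹ *ᵥ u) ⬝ᵥ v := by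
    rw [dotProduct_mulVec, ← mulVec_transpose, transpose_nonsing_inv, hKs.eq]
  have hq : q ⬝ᵥ Pᵀ *ᵥ (K⁻¹ *ᵥ b) - q ⬝ᵥ Pᵀ *ᵥ (K⁻¹ *ᵥ (P *ᵥ y)) =
      q ⬝ᵥ r + s⁻¹ * (q ⬝ᵥ y) := by
    have h := congrArg (q ⬝ᵥ ·) hy
    simp only [add_mulVec, smul_mulVec, one_mulVec, ← mulVec_mulVec, dotProduct_add,
      dotProduct_sub, dotProduct_smul, smul_eq_mul] at h
    linear_combination -h
  have ha : a ⬝ᵥ K⁻¹ *ᵥ (P *ᵥ y) = (Pᵀ *ᵥ (K⁻¹ *ᵥ a)) ⬝ᵥ y := by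
    rw [hKinv, dotProduct_comm, hP, dotProduct_comm]
  rw [inv_add_smul_mul_transpose_mulVec hs hK hA hy, add_dotProduct, smul_dotProduct, hP,
    mulVec_sub, dotProduct_sub, dotProduct_sub, hq, ha, sub_dotProduct, smul_eq_mul, mul_add,
    mul_inv_cancel_left₀ hs]
  ring

theorem tendsto_inv_smul_one_add {G : Matrix k k ℝ} (hG : IsUnit G) {ι : Type*} {l : Filter ι}
    {ε : ι → ℝ} (hε : Tendsto ε l (nhds 0)) :
    Tendsto (fun i => (ε i • 1 + G)⁻¹) l (nhds G⁻¹) := by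
  have hdet : ContinuousAt Ring.inverse G.det := by
    rw [Ring.inverse_eq_inv']
    exact continuousAt_inv₀ ((isUnit_iff_isUnit_det G).1 hG).ne_zero
  refine (continuousAt_matrix_inv G hdet).tendsto.comp ?_
  simpa using (hε.smul_const (1 : Matrix k k ℝ)).add_const G

end Matrix

theorem stmt_5 (n Q : ℕ) (hnQ : Q ≤ n)
    (K : Matrix (Fin n) (Fin n) ℝ) (hK : K.PosDef)
    (P : Matrix (Fin n) (Fin Q) ℝ) (hP : P.rank = Q)
    (a b : Fin n → ℝ) (q r : Fin Q → ℝ) (c : ℝ) :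
    (∀ σ : ℝ, 0 < σ → IsUnit (K + σ ^ 2 • (P * Pᵀ))) ∧
      Tendsto
        (fun σ : ℝ =>
          c + σ ^ 2 * (q ⬝ᵥ r) -
            (a + σ ^ 2 • P.mulVec q) ⬝ᵥ
              (K + σ ^ 2 • (P * Pᵀ))⁻¹.mulVec (b + σ ^ 2 • P.mulVec r))
        atTop
        (nhds (c - a ⬝ᵥ K⁻¹.mulVec b +
          (Pᵀ.mulVec (K⁻¹.mulVec a) - q) ⬝ᵥ
            (Pᵀ * K⁻¹ * P)⁻¹.mulVec (Pᵀ.mulVec (K⁻¹.mulVec b) - r))) := by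
  have hs {σ : ℝ} (hσ : 0 < σ) : 0 < σ ^ 2 := pow_pos hσ 2
  have hA (σ : ℝ) (hσ : 0 < σ) : IsUnit (K + σ ^ 2 • (P * Pᵀ)) := by
    have hPP : (P * Pᵀ).PosSemidef := by simpa using posSemidef_self_mul_conjTranspose P
    exact (hK.add_posSemidef (hPP.smul (hs hσ).le)).isUnit
  have hG : (Pᵀ * K⁻¹ * P).PosDef := by
    have hinj : Function.Injective P.mulVec := mulVec_injective_of_rank_eq_card (by simpa using hP)
    simpa using hK.inv.conjTranspose_mul_mul_same hinj
  have hKs : K.IsSymm := by simpa using hK.isHermitian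
  refine ⟨hA, ?_⟩
  have hinv : Tendsto (fun σ : ℝ => ((σ ^ 2)⁻¹ • 1 + Pᵀ * K⁻¹ * P)⁻¹) atTop
      (nhds (Pᵀ * K⁻¹ * P)⁻¹) :=
    tendsto_inv_smul_one_add hG.isUnit (tendsto_pow_atTop two_ne_zero).inv_tendsto_atTop
  have hcont : Continuous fun N : Matrix (Fin Q) (Fin Q) ℝ =>
      c - a ⬝ᵥ K⁻¹ *ᵥ b + (Pᵀ *ᵥ (K⁻¹ *ᵥ a) - q) ⬝ᵥ N *ᵥ (Pᵀ *ᵥ (K⁻¹ *ᵥ b) - r) := by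
    fun_prop
  refine ((hcont.tendsto _).comp hinv).congr' ?_
  filter_upwards [eventually_gt_atTop 0] with σ hσ
  have hM : ((σ ^ 2)⁻¹ • 1 + Pᵀ * K⁻¹ * P).PosDef :=
    (PosDef.one.smul (inv_pos.2 (hs hσ))).add hG
  exact (add_mul_dotProduct_sub_dotProduct_inv_mulVec (hs hσ).ne' hKs hK.isUnit (hA σ hσ)
    hM.isUnit a b q r c).symm
end

section
/- Let K be a symmetric positive definite real n×n matrix, let 𝟙 ∈ ℝⁿ be the vector of ones, and let z ∈ ℝⁿ. Then 𝟙ᵀK⁻¹𝟙 > 0, and the vector w = (I − K⁻¹𝟙𝟙ᵀ/(𝟙ᵀK⁻¹𝟙)) K⁻¹ z + K⁻¹𝟙/(𝟙ᵀK⁻¹𝟙) is the unique w ∈ ℝⁿ for which there exists c ∈ ℝ with Kw + c𝟙 = z and 𝟙ᵀw = 1; in particular the entries of w sum to one. -/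
open Matrix

/-- Solution of the bordered linear system `K w + c u = z`, `u ⬝ᵥ w = 1`. -/
lemma mulVec_add_smul_eq_and_dotProduct_eq_one_iff {ι F : Type*} [Fintype ι] [DecidableEq ι]
    [Field F] {K : Matrix ι ι F} (hK : IsUnit K.det) {u : ι → F}
    (hs : u ⬝ᵥ K⁻¹ *ᵥ u ≠ 0) (z w : ι → F) (c : F) :
    (K *ᵥ w + c • u = z ∧ u ⬝ᵥ w = 1) ↔
      w = K⁻¹ *ᵥ z - c • K⁻¹ *ᵥ u ∧
        c = (u ⬝ᵥ K⁻¹ *ᵥ u)⁻¹ * (u ⬝ᵥ K⁻¹ *ᵥ z - 1) := by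
  have hw : K *ᵥ w + c • u = z ↔ w = K⁻¹ *ᵥ z - c • K⁻¹ *ᵥ u := by
    constructor
    · rintro rfl
      simp [mulVec_add, mulVec_smul, mulVec_mulVec, nonsing_inv_mul K hK]
    · rintro rfl
      simp [mulVec_sub, mulVec_smul, mulVec_mulVec, mul_nonsing_inv K hK]
  rw [hw]
  refine and_congr_right ?_
  rintro rfl
  rw [dotProduct_sub, dotProduct_smul, smul_eq_mul, eq_inv_mul_iff_mul_eq₀ hs]
  constructor <;> intro h <;> linear_combination -h

/-- Rewriting of the closed-form weights as a kernel solution minus a multiple of `K⁻¹ u`. -/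
lemma one_sub_smul_mulVec_add_smul {ι F : Type*} [Fintype ι] [DecidableEq ι] [Field F]
    (A : Matrix ι ι F) (u y : ι → F) (t : F) :
    (1 - t • (A * vecMulVec u u)) *ᵥ y + t • A *ᵥ u =
      y - (t * (u ⬝ᵥ y - 1)) • A *ᵥ u := by
  rw [sub_mulVec, one_mulVec, smul_mulVec, ← mulVec_mulVec, vecMulVec_mulVec, op_smul_eq_smul,
    mulVec_smul]
  module

theorem stmt_9 (n : ℕ) (hn : 0 < n)
    (K : Matrix (Fin n) (Fin n) ℝ) (hK : K.PosDef)
    (z : Fin n → ℝ) :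
    0 < (fun _ : Fin n => (1 : ℝ)) ⬝ᵥ K⁻¹.mulVec (fun _ => 1) ∧
      ∀ w : Fin n → ℝ,
        w = ((1 : Matrix (Fin n) (Fin n) ℝ) -
              ((fun _ : Fin n => (1 : ℝ)) ⬝ᵥ K⁻¹.mulVec fun _ => 1)⁻¹ •
                (K⁻¹ * vecMulVec (fun _ => 1) (fun _ => 1))).mulVec (K⁻¹.mulVec z) +
            ((fun _ : Fin n => (1 : ℝ)) ⬝ᵥ K⁻¹.mulVec fun _ => 1)⁻¹ •
              K⁻¹.mulVec (fun _ => 1) →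
          ((∃ c : ℝ, K.mulVec w + c • (fun _ => (1 : ℝ)) = z) ∧
            (fun _ : Fin n => (1 : ℝ)) ⬝ᵥ w = 1 ∧
            (∀ w' : Fin n → ℝ,
              (∃ c : ℝ, K.mulVec w' + c • (fun _ => (1 : ℝ)) = z) →
              (fun _ : Fin n => (1 : ℝ)) ⬝ᵥ w' = 1 → w' = w) ∧
            ∑ i, w i = 1) := by
  have hdet : IsUnit K.det := hK.det_pos.ne'.isUnit
  have hs : 0 < (fun _ : Fin n => (1 : ℝ)) ⬝ᵥ K⁻¹.mulVec (fun _ => 1) := by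
    have hne : (fun _ : Fin n => (1 : ℝ)) ≠ 0 := fun h => one_ne_zero (congrFun h ⟨0, hn⟩)
    simpa using hK.inv.dotProduct_mulVec_pos hne
  refine ⟨hs, fun w hw => ?_⟩
  rw [one_sub_smul_mulVec_add_smul] at hw
  obtain ⟨hw_eq, hw_one⟩ :=
    (mulVec_add_smul_eq_and_dotProduct_eq_one_iff hdet hs.ne' z w _).2 ⟨hw, rfl⟩
  refine ⟨⟨_, hw_eq⟩, hw_one, ?_, by simpa [dotProduct] using hw_one⟩
  rintro w' ⟨c, hc⟩ hw'
  obtain ⟨rfl, rfl⟩ :=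
    (mulVec_add_smul_eq_and_dotProduct_eq_one_iff hdet hs.ne' z w' c).1 ⟨hc, hw'⟩
  exact hw.symm
end

section
/- Let K be a symmetric positive definite real n×n matrix, let P be an invertible real n×n matrix, and let z, b ∈ ℝⁿ and c ∈ ℝ. Let (w, w_π) ∈ ℝⁿ × ℝⁿ be the unique solution of Kw + Pw_π = z and Pᵀw = b. Then w = P⁻ᵀ b (in particular w does not depend on K or z), and c − zᵀK⁻¹z + (zᵀK⁻¹P − bᵀ) w_π = c − 2 zᵀ w + wᵀ K w. -/
open Matrix

theorem stmt_10 (n : ℕ)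
    (K : Matrix (Fin n) (Fin n) ℝ) (hK : K.PosDef)
    (P : Matrix (Fin n) (Fin n) ℝ) (hP : IsUnit P)
    (z b : Fin n → ℝ) (c : ℝ)
    (w wπ : Fin n → ℝ)
    (hsol : K.mulVec w + P.mulVec wπ = z ∧ Pᵀ.mulVec w = b) :
    w = (Pᵀ)⁻¹.mulVec b ∧
      c - z ⬝ᵥ K⁻¹.mulVec z + (Matrix.vecMul z (K⁻¹ * P) - b) ⬝ᵥ wπ =
        c - 2 * (z ⬝ᵥ w) + w ⬝ᵥ K.mulVec w := by
  obtain ⟨hz, hb⟩ := hsol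
  have hPt : IsUnit (Pᵀ).det := by
    rw [det_transpose]
    exact (isUnit_iff_isUnit_det P).mp hP
  have hKdet : IsUnit K.det := (isUnit_iff_isUnit_det K).mp hK.isUnit
  refine ⟨by rw [← hb, mulVec_mulVec, nonsing_inv_mul _ hPt, one_mulVec], ?_⟩
  have hKz : K⁻¹.mulVec z = w + (K⁻¹ * P).mulVec wπ := by
    rw [← hz, mulVec_add, mulVec_mulVec, mulVec_mulVec, nonsing_inv_mul _ hKdet, one_mulVec]
  have hbw : b ⬝ᵥ wπ = w ⬝ᵥ P.mulVec wπ := by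
    rw [← hb, mulVec_transpose, dotProduct_mulVec]
  have hzw : z ⬝ᵥ w = w ⬝ᵥ K.mulVec w + w ⬝ᵥ P.mulVec wπ := by
    rw [← dotProduct_add, hz, dotProduct_comm]
  rw [hKz, dotProduct_add, sub_dotProduct, ← dotProduct_mulVec, hbw]
  linarith
end

section
/- Let ν be a Borel probability measure on ℝ^d such that ν({x}) = 0 for every x ∈ ℝ^d and ν(U) > 0 for every nonempty open set U ⊆ ℝ^d. Let x_1, …, x_n ∈ ℝ^d be distinct points and let w ∈ ℝⁿ have all entries nonzero. Then there exist ν-integrable Borel functions p_1, …, p_n : ℝ^d → ℝ such that the matrix M with entries M_{ij} = p_j(x_i) is invertible and the unique v ∈ ℝⁿ satisfying Σ_{i=1}^n v_i p_j(x_i) = ∫ p_j dν for all j ∈ {1, …, n} is v = w. -/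
open MeasureTheory Matrix

/-- The function equal to `1` off the nodes, to `c` at the node `x j` and to `0` at the others. -/
noncomputable def nodeFunction {ι α : Type*} (x : ι → α) (j : ι) (c : ℝ) : α → ℝ :=
  (Set.range x)ᶜ.indicator 1 + ({x j} : Set α).indicator (fun _ => c)

theorem nodeFunction_apply_node {ι α : Type*} [DecidableEq ι] {x : ι → α}
    (hx : Function.Injective x) (j : ι) (c : ℝ) (i : ι) :
    nodeFunction x j c (x i) = if i = j then c else 0 := by
  by_cases hij : i = j <;> simp [nodeFunction, hx.eq_iff, hij]

theorem measurable_nodeFunction {ι α : Type*} [Countable ι] [MeasurableSpace α]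
    [MeasurableSingletonClass α] (x : ι → α) (j : ι) (c : ℝ) :
    Measurable (nodeFunction x j c) :=
  (measurable_one.indicator (Set.countable_range x).measurableSet.compl).add
    (measurable_const.indicator (measurableSet_singleton _))

theorem nodeFunction_ae_eq_one {ι α : Type*} [Countable ι] [MeasurableSpace α] {ν : Measure α}
    (hatom : ∀ a, ν {a} = 0) (x : ι → α) (j : ι) (c : ℝ) :
    nodeFunction x j c =ᵐ[ν] fun _ => 1 := by
  have hnodes : ∀ᵐ y ∂ν, ∀ i, y ≠ x i :=
    ae_all_iff.2 fun i => by simp [ae_iff, hatom]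
  filter_upwards [hnodes] with y hy
  have hrange : y ∉ Set.range x := fun ⟨i, hi⟩ => hy i hi.symm
  simp [nodeFunction, hrange, hy j]

theorem stmt_12 (d n : ℕ)
    (ν : Measure (Fin d → ℝ)) [IsProbabilityMeasure ν]
    (hatom : ∀ x : Fin d → ℝ, ν {x} = 0)
    (hopen : ∀ U : Set (Fin d → ℝ), IsOpen U → U.Nonempty → 0 < ν U)
    (x : Fin n → (Fin d → ℝ)) (hx : Function.Injective x)
    (w : Fin n → ℝ) (hw : ∀ i, w i ≠ 0) :
    ∃ p : Fin n → (Fin d → ℝ) → ℝ,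
      (∀ j, Measurable (p j)) ∧
      (∀ j, Integrable (p j) ν) ∧
      IsUnit (Matrix.of fun i j => p j (x i)) ∧
      (∀ v : Fin n → ℝ,
        (∀ j, ∑ i, v i * p j (x i) = ∫ y, p j y ∂ν) ↔ v = w) := by
  have hae j := nodeFunction_ae_eq_one hatom x j (w j)⁻¹
  refine ⟨fun j => nodeFunction x j (w j)⁻¹, fun j => measurable_nodeFunction _ _ _,
    fun j => (integrable_const 1).congr (hae j).symm, ?_, fun v => ?_⟩
  · have hdiag : (Matrix.of fun i j => nodeFunction x j (w j)⁻¹ (x i)) =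
        Matrix.diagonal fun i => (w i)⁻¹ := by
      ext i j
      by_cases hij : i = j <;> simp [nodeFunction_apply_node hx, hij]
    rw [hdiag, Matrix.isUnit_diagonal, Pi.isUnit_iff]
    exact fun i => (inv_ne_zero (hw i)).isUnit
  · simp only [integral_congr_ae (hae _), nodeFunction_apply_node hx, funext_iff]
    refine forall_congr' fun j => ?_
    simp [mul_inv_eq_one₀ (hw j)]
end
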